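/- arXiv:hep-th/0212282 — 5 statements merged into one kernel-verified Lean document; each statement's English description precedes it below -/
import Mathlib

section
/- Let f : ℂ → ℂ be analytic on the open lower half-plane ℂ₋ and satisfy the radial Hardy bound from below C := R₋(f) = sup_{−π<φ<0} ∫₀^∞ |f(r e^{iφ})|² dr < ∞. Define F₋ : ℂ₋ → ℂ by F₋(z) = f(z^{1/2}) · z^{−1/4}, using principal branch powers. Then F₋ is analytic on ℂ₋ and satisfies the radial Hardy bound from below R₋(F₋) = sup_{−π<φ<0} ∫₀^∞ |F₋(r e^{iφ})|² dr ≤ 2C. -/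
open MeasureTheory Set
open scoped ENNReal

/-- Radial Hardy bound from below: `sup_{−π<φ<0} ∫₀^∞ |f(r e^{iφ})|² dr`. -/
noncomputable def Rminus (f : ℂ → ℂ) : ℝ≥0∞ :=
  ⨆ φ ∈ Set.Ioo (-Real.pi) (0 : ℝ),
    ∫⁻ r in Set.Ioi (0 : ℝ), (‖f ((r : ℂ) * Complex.exp ((φ : ℂ) * Complex.I))‖₊ : ℝ≥0∞) ^ 2

theorem log_sq_mul_exp {s φ : ℝ} (hs : 0 < s) (hφ : φ ∈ Set.Ioo (-Real.pi) 0) :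
    Complex.log (((s ^ 2 : ℝ) : ℂ) * Complex.exp ((φ : ℂ) * Complex.I)) =
      2 * (Real.log s : ℂ) + (φ : ℂ) * Complex.I := by
  have hpos : (0 : ℝ) < s ^ 2 := by positivity
  rw [Complex.log_ofReal_mul hpos (Complex.exp_ne_zero _), Complex.log_exp]
  · rw [Real.log_pow]
    push_cast
    ring
  · simpa using hφ.1
  · simpa using hφ.2.le.trans Real.pi_pos.le

theorem sq_mul_exp_ne_zero {s φ : ℝ} (hs : 0 < s) :
    ((s ^ 2 : ℝ) : ℂ) * Complex.exp ((φ : ℂ) * Complex.I) ≠ 0 :=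
  mul_ne_zero (by exact_mod_cast (by positivity : s ^ 2 ≠ 0)) (Complex.exp_ne_zero _)

theorem sq_mul_exp_cpow_half {s φ : ℝ} (hs : 0 < s) (hφ : φ ∈ Set.Ioo (-Real.pi) 0) :
    (((s ^ 2 : ℝ) : ℂ) * Complex.exp ((φ : ℂ) * Complex.I)) ^ ((1 : ℂ) / 2) =
      (s : ℂ) * Complex.exp (((φ / 2 : ℝ) : ℂ) * Complex.I) := by
  rw [Complex.cpow_def_of_ne_zero (sq_mul_exp_ne_zero hs), log_sq_mul_exp hs hφ]
  conv_rhs => rw [← Real.exp_log hs, Complex.ofReal_exp, ← Complex.exp_add]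
  push_cast
  ring_nf

theorem norm_sq_mul_exp_cpow_neg_quarter_sq {s φ : ℝ} (hs : 0 < s)
    (hφ : φ ∈ Set.Ioo (-Real.pi) 0) :
    ‖(((s ^ 2 : ℝ) : ℂ) * Complex.exp ((φ : ℂ) * Complex.I)) ^ (-(1 : ℂ) / 4)‖ ^ 2 = s⁻¹ := by
  rw [Complex.cpow_def_of_ne_zero (sq_mul_exp_ne_zero hs), log_sq_mul_exp hs hφ,
    Complex.norm_exp, ← Real.exp_nat_mul]
  have h : (2 * (Real.log s : ℂ) + (φ : ℂ) * Complex.I) * (-(1 : ℂ) / 4) =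
      ((-(Real.log s) / 2 : ℝ) : ℂ) + ((-φ / 4 : ℝ) : ℂ) * Complex.I := by
    push_cast
    ring
  rw [h, Complex.add_re, Complex.ofReal_re, Complex.re_ofReal_mul, Complex.I_re]
  have h2 : ((2 : ℕ) : ℝ) * (-(Real.log s) / 2 + -φ / 4 * 0) = -Real.log s := by
    push_cast
    ring
  rw [h2, Real.exp_neg, Real.exp_log hs]

theorem cpow_half_im_neg {z : ℂ} (hz : z.im < 0) : (z ^ ((1 : ℂ) / 2)).im < 0 := by
  have hz0 : z ≠ 0 := by
    rintro rfl
    simp at hz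
  have h1 := Complex.arg_neg_iff.2 hz
  have h2 := Complex.neg_pi_lt_arg z
  rw [Complex.cpow_def_of_ne_zero hz0, Complex.exp_im]
  have h : (Complex.log z * (1 / 2)).im = z.arg / 2 := by
    simp [Complex.mul_im, Complex.log_im]
    ring
  rw [h]
  exact mul_neg_of_pos_of_neg (Real.exp_pos _)
    (Real.sin_neg_of_neg_of_neg_pi_lt (by linarith) (by linarith))

theorem lintegral_Ioi_comp_sq (g : ℝ → ℝ≥0∞) :
    ∫⁻ r in Set.Ioi (0 : ℝ), g r =
      ∫⁻ s in Set.Ioi (0 : ℝ), ENNReal.ofReal (2 * s) * g (s ^ 2) := by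
  have himage : (fun s : ℝ => s ^ 2) '' Set.Ioi 0 = Set.Ioi 0 := by
    ext r
    constructor
    · rintro ⟨s, hs, rfl⟩
      exact pow_pos (Set.mem_Ioi.1 hs) 2
    · intro hr
      exact ⟨√r, Real.sqrt_pos.2 hr, Real.sq_sqrt (le_of_lt hr)⟩
  have hinj : Set.InjOn (fun s : ℝ => s ^ 2) (Set.Ioi 0) := fun a ha b hb hab =>
    (pow_left_inj₀ (le_of_lt ha) (le_of_lt hb) two_ne_zero).1 hab
  have key := lintegral_image_eq_lintegral_abs_deriv_mul (f := fun s : ℝ => s ^ 2)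
    (f' := fun s => 2 * s) measurableSet_Ioi
    (fun s _ => by simpa using (hasDerivAt_pow 2 s).hasDerivWithinAt) hinj g
  rw [himage] at key
  rw [key]
  refine setLIntegral_congr_fun measurableSet_Ioi fun s hs => ?_
  have hs' : (0 : ℝ) < s := hs
  simp only [abs_of_pos (mul_pos two_pos hs')]

theorem stmt0 (f : ℂ → ℂ)
    (hf : AnalyticOnNhd ℂ f {z : ℂ | z.im < 0})
    (hC : Rminus f < ∞) :
    AnalyticOnNhd ℂ (fun z : ℂ => f (z ^ ((1 : ℂ) / 2)) * z ^ (-(1 : ℂ) / 4))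
        {z : ℂ | z.im < 0} ∧
    Rminus (fun z : ℂ => f (z ^ ((1 : ℂ) / 2)) * z ^ (-(1 : ℂ) / 4)) ≤ 2 * Rminus f := by
  refine ⟨fun z hz => ?_, iSup₂_le fun φ hφ => ?_⟩
  · have hslit : z ∈ Complex.slitPlane := Or.inr (ne_of_lt hz)
    have hroot := hf (z ^ ((1 : ℂ) / 2)) (cpow_half_im_neg hz)
    exact (hroot.comp_of_eq (f := fun w : ℂ => w ^ ((1 : ℂ) / 2))
      (analyticAt_id.cpow analyticAt_const hslit) rfl).mul
      (analyticAt_id.cpow analyticAt_const hslit)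
  · rw [lintegral_Ioi_comp_sq]
    have hφ2 : φ / 2 ∈ Set.Ioo (-Real.pi) (0 : ℝ) :=
      ⟨by linarith [hφ.1, Real.pi_pos], by linarith [hφ.2]⟩
    calc
      _ = ∫⁻ s in Set.Ioi (0 : ℝ), 2 *
          (‖f ((s : ℂ) * Complex.exp (((φ / 2 : ℝ) : ℂ) * Complex.I))‖₊ : ℝ≥0∞) ^ 2 := by
        refine setLIntegral_congr_fun measurableSet_Ioi fun s hs => ?_
        have hs' : (0 : ℝ) < s := hs
        simp only [← enorm_eq_nnnorm, enorm_mul, mul_pow]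
        have hw : ‖(((s ^ 2 : ℝ) : ℂ) * Complex.exp ((φ : ℂ) * Complex.I)) ^
            (-(1 : ℂ) / 4)‖ₑ ^ 2 = ENNReal.ofReal s⁻¹ := by
          rw [← ofReal_norm, ← ENNReal.ofReal_pow (norm_nonneg _),
            norm_sq_mul_exp_cpow_neg_quarter_sq hs' hφ]
        rw [hw, sq_mul_exp_cpow_half hs' hφ, mul_left_comm,
          ← ENNReal.ofReal_mul (by positivity), mul_assoc, mul_inv_cancel₀ hs'.ne', mul_one,
          ENNReal.ofReal_ofNat, mul_comm]
      _ = 2 * ∫⁻ s in Set.Ioi (0 : ℝ),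
          (‖f ((s : ℂ) * Complex.exp (((φ / 2 : ℝ) : ℂ) * Complex.I))‖₊ : ℝ≥0∞) ^ 2 :=
        lintegral_const_mul' _ _ ENNReal.ofNat_ne_top
      _ ≤ 2 * Rminus f := by
        gcongr
        exact le_iSup₂_of_le (φ / 2) hφ2 le_rfl
end

section
/- For every real b > 0 there exists a function g : ℂ → ℂ such that: (i) g is analytic on the open lower half-plane ℂ₋ and continuous on the closed lower half-plane {z : Im z ≤ 0}; (ii) the restriction of g to ℝ is a Schwartz function all of whose derivatives vanish at 0; (iii) g satisfies the radial Hardy bound from below, R₋(g) = sup_{−π<φ<0} ∫₀^∞ |g(r e^{iφ})|² dr < ∞; and yet (iv) the function z ↦ exp(i b z^{1/2}) · g(z) (principal square root) fails the radial Hardy bound from below: sup_{−π<φ<0} ∫₀^∞ |exp(i b (r e^{iφ})^{1/2}) g(r e^{iφ})|² dr = ∞. -/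
open MeasureTheory Set
open scoped ENNReal

/-- The branch of `(i z)^{1/4}` that is analytic on the open lower half-plane. -/
noncomputable def quarterRoot (z : ℂ) : ℂ :=
  (Complex.I * z) ^ (((1 / 4 : ℝ) : ℝ) : ℂ)

/-- The functions `u ^ n * exp (-(u + u⁻¹))` with `u = (i z)^{1/4}`, extended by `0` at `0`. -/
noncomputable def flatFun (n : ℤ) (z : ℂ) : ℂ :=
  if z = 0 then 0 else quarterRoot z ^ n * Complex.exp (-(quarterRoot z + (quarterRoot z)⁻¹))

@[simp] lemma flatFun_zero (n : ℤ) : flatFun n 0 = 0 := by simp [flatFun]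

lemma flatFun_of_ne {z : ℂ} (hz : z ≠ 0) (n : ℤ) : flatFun n z =
    quarterRoot z ^ n * Complex.exp (-(quarterRoot z + (quarterRoot z)⁻¹)) := by
  simp [flatFun, hz]

lemma norm_quarterRoot (z : ℂ) : ‖quarterRoot z‖ = ‖z‖ ^ (1 / 4 : ℝ) := by
  rw [quarterRoot, Complex.norm_cpow_real]; simp

lemma norm_quarterRoot_pos {z : ℂ} (hz : z ≠ 0) : 0 < ‖quarterRoot z‖ := by
  rw [norm_quarterRoot]; exact Real.rpow_pos_of_pos (norm_pos_iff.2 hz) _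

lemma norm_quarterRoot_pow_four (z : ℂ) : ‖quarterRoot z‖ ^ 4 = ‖z‖ := by
  rw [norm_quarterRoot, ← Real.rpow_natCast, ← Real.rpow_mul (norm_nonneg z)]; norm_num

lemma half_norm_le_re_quarterRoot {z : ℂ} (hz : z.im ≤ 0) :
    ‖quarterRoot z‖ / 2 ≤ (quarterRoot z).re := by
  have h1 : |(Complex.I * z).arg| ≤ Real.pi / 2 := by
    rw [Complex.abs_arg_le_pi_div_two_iff]; simpa using hz
  have h2 : (1 : ℝ) / 2 ≤ Real.cos ((Complex.I * z).arg * (1 / 4)) := by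
    rw [← Real.cos_pi_div_three, ← Real.cos_abs (_ * _)]
    have := Real.pi_pos
    apply Real.cos_le_cos_of_nonneg_of_le_pi (abs_nonneg _) (by linarith)
    rw [abs_mul, abs_of_pos (by norm_num : (0 : ℝ) < 1 / 4)]
    linarith
  rw [norm_quarterRoot, quarterRoot, Complex.cpow_ofReal_re]
  have h3 : ‖Complex.I * z‖ = ‖z‖ := by simp
  rw [h3]
  have := Real.rpow_nonneg (norm_nonneg z) (1 / 4 : ℝ)
  nlinarith

lemma exists_zpow_mul_exp_le (n : ℤ) :
    ∃ C : ℝ, ∀ t : ℝ, 0 < t → t ^ n * Real.exp (-(t + t⁻¹) / 2) ≤ C := by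
  have key : ∀ k : ℕ, ∀ t : ℝ, 0 < t →
      t ^ k * Real.exp (-(t + t⁻¹) / 2) ≤ 2 ^ k * k.factorial := by
    intro k t ht
    have h := Real.pow_div_factorial_le_exp (t / 2) (by positivity) k
    have hf : (0 : ℝ) < k.factorial := by positivity
    rw [div_le_iff₀ hf, div_pow, div_le_iff₀ (by positivity)] at h
    have h2 : Real.exp (-(t + t⁻¹) / 2) ≤ Real.exp (-(t / 2)) := by
      apply Real.exp_le_exp.2
      have := inv_pos.2 ht
      linarith
    calc t ^ k * Real.exp (-(t + t⁻¹) / 2)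
        ≤ (Real.exp (t / 2) * k.factorial * 2 ^ k) * Real.exp (-(t / 2)) := by gcongr
      _ = (Real.exp (t / 2) * Real.exp (-(t / 2))) * (2 ^ k * k.factorial) := by ring
      _ = 2 ^ k * k.factorial := by rw [← Real.exp_add]; simp
  obtain ⟨k, rfl | rfl⟩ := n.eq_nat_or_neg
  · exact ⟨_, fun t ht => by simpa using key k t ht⟩
  · refine ⟨2 ^ k * k.factorial, fun t ht => ?_⟩
    have := key k t⁻¹ (inv_pos.2 ht)
    rwa [inv_inv, inv_pow, ← zpow_natCast, ← zpow_neg, add_comm] at this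

lemma exists_norm_flatFun_le (n : ℤ) :
    ∃ C : ℝ, 0 ≤ C ∧ ∀ z : ℂ, z.im ≤ 0 → ‖flatFun n z‖ ≤ C := by
  obtain ⟨C, hC⟩ := exists_zpow_mul_exp_le n
  refine ⟨max C 0, le_max_right _ _, fun z hz => ?_⟩
  rcases eq_or_ne z 0 with rfl | h0
  · simp
  have hp := norm_quarterRoot_pos h0
  refine le_trans ?_ ((hC _ hp).trans (le_max_left _ _))
  rw [flatFun_of_ne h0, norm_mul, norm_zpow, Complex.norm_exp]
  gcongr
  have h1 := half_norm_le_re_quarterRoot hz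
  have h2 : ‖quarterRoot z‖⁻¹ / 2 ≤ ((quarterRoot z)⁻¹).re := by
    rw [Complex.inv_re, Complex.normSq_eq_norm_sq, le_div_iff₀ (by positivity)]
    calc ‖quarterRoot z‖⁻¹ / 2 * ‖quarterRoot z‖ ^ 2 = ‖quarterRoot z‖ / 2 := by
          field_simp
      _ ≤ _ := h1
  simp only [Complex.neg_re, Complex.add_re]
  linarith

lemma norm_pow_mul_norm_flatFun (m : ℕ) (n : ℤ) (z : ℂ) :
    ‖z‖ ^ m * ‖flatFun n z‖ = ‖flatFun (n + 4 * m) z‖ := by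
  rcases eq_or_ne z 0 with rfl | h0
  · simp
  have hp := (norm_quarterRoot_pos h0).ne'
  rw [flatFun_of_ne h0, flatFun_of_ne h0, norm_mul, norm_mul, norm_zpow, norm_zpow,
    zpow_add₀ hp, zpow_mul, zpow_natCast, ← norm_quarterRoot_pow_four z]
  norm_cast
  ring

lemma exists_norm_flatFun_le_norm_pow (m : ℕ) (n : ℤ) :
    ∃ C : ℝ, ∀ z : ℂ, z.im ≤ 0 → ‖flatFun n z‖ ≤ C * ‖z‖ ^ m := by
  obtain ⟨C, -, hC⟩ := exists_norm_flatFun_le (n - 4 * m)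
  refine ⟨C, fun z hz => ?_⟩
  have h := norm_pow_mul_norm_flatFun m (n - 4 * m) z
  rw [sub_add_cancel] at h
  rw [← h, mul_comm]
  gcongr
  exact hC z hz

lemma I_mul_mem_slitPlane {z : ℂ} (hz : z.im ≤ 0) (h0 : z ≠ 0) :
    Complex.I * z ∈ Complex.slitPlane := by
  rw [Complex.mem_slitPlane_iff]
  simp only [Complex.mul_re, Complex.I_re, Complex.I_im, Complex.mul_im, zero_mul, one_mul,
    zero_sub, zero_add]
  rcases hz.lt_or_eq with h | h
  · left; linarith
  · right; intro h'; exact h0 (Complex.ext h' h)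

lemma hasDerivAt_quarterRoot {z : ℂ} (hz : z.im ≤ 0) (h0 : z ≠ 0) :
    HasDerivAt quarterRoot (Complex.I / 4 * quarterRoot z ^ (-3 : ℤ)) z := by
  have h1 : HasDerivAt (fun w : ℂ => Complex.I * w) Complex.I z := by
    simpa using (hasDerivAt_id z).const_mul Complex.I
  have h2 := h1.cpow_const (c := ((1 / 4 : ℝ) : ℂ)) (I_mul_mem_slitPlane hz h0)
  refine h2.congr_deriv ?_
  rw [quarterRoot, ← Complex.cpow_mul_int]
  push_cast
  rw [show (1 / 4 : ℂ) * -3 = 1 / 4 - 1 by norm_num]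
  ring

lemma hasDerivAt_flatFun {z : ℂ} (hz : z.im ≤ 0) (h0 : z ≠ 0) (n : ℤ) :
    HasDerivAt (flatFun n) (Complex.I / 4 *
      (n * flatFun (n - 4) z - flatFun (n - 3) z + flatFun (n - 5) z)) z := by
  have hu0 : quarterRoot z ≠ 0 := norm_pos_iff.1 (norm_quarterRoot_pos h0)
  have hu := hasDerivAt_quarterRoot hz h0
  have h1 := (hasDerivAt_zpow n (quarterRoot z) (Or.inl hu0)).comp z hu
  have h2 := ((hu.add (hu.inv hu0)).neg).cexp
  have h3 := h1.mul h2
  refine (h3.congr_of_eventuallyEq ?_).congr_deriv ?_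
  · filter_upwards [isOpen_ne.mem_nhds h0] with w hw
    simp [flatFun_of_ne hw]
  · simp only [flatFun_of_ne h0, zpow_sub₀ hu0, Function.comp_apply, Pi.add_apply, Pi.neg_apply,
      Pi.inv_apply]
    generalize quarterRoot z = u at *
    generalize Complex.exp _ = e
    rw [zpow_neg, zpow_one]
    have e3 : u ^ (3 : ℤ) = u ^ 3 := by norm_cast
    have e4 : u ^ (4 : ℤ) = u ^ 4 := by norm_cast
    have e5 : u ^ (5 : ℤ) = u ^ 5 := by norm_cast
    rw [e3, e4, e5]
    field_simp
    ring

lemma hasDerivAt_flatFun_ofReal (n : ℤ) (s : ℝ) :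
    HasDerivAt (fun t : ℝ => flatFun n t) (Complex.I / 4 *
      (n * flatFun (n - 4) s - flatFun (n - 3) s + flatFun (n - 5) s)) s := by
  rcases eq_or_ne s 0 with rfl | h0
  · obtain ⟨C, hC⟩ := exists_norm_flatFun_le_norm_pow 2 n
    have hO : (fun t : ℝ => flatFun n t) =O[nhds 0] fun t => ‖t - 0‖ ^ 2 := by
      refine Asymptotics.IsBigO.of_bound C (Filter.Eventually.of_forall fun t => ?_)
      simpa using hC t (by simp)
    have h := (hO.hasFDerivAt one_lt_two).hasDerivAt
    simpa using h
  · exact (hasDerivAt_flatFun (by simp) (by exact_mod_cast h0) n).comp_ofReal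

/-- The span of the restrictions of the functions `flatFun n` to the real line. -/
noncomputable def flatSpan : Submodule ℂ (ℝ → ℂ) :=
  Submodule.span ℂ (Set.range fun (n : ℤ) (s : ℝ) => flatFun n s)

lemma flatFun_mem_flatSpan (n : ℤ) : (fun s : ℝ => flatFun n s) ∈ flatSpan :=
  Submodule.subset_span ⟨n, rfl⟩

lemma exists_hasDerivAt_of_mem_flatSpan {f : ℝ → ℂ} (hf : f ∈ flatSpan) :
    ∃ f' ∈ flatSpan, ∀ s, HasDerivAt f (f' s) s := by
  induction hf using Submodule.span_induction with
  | mem f h =>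
    obtain ⟨n, rfl⟩ := h
    refine ⟨(Complex.I / 4) • ((n : ℂ) • (fun s : ℝ => flatFun (n - 4) s) -
      (fun s : ℝ => flatFun (n - 3) s) + fun s : ℝ => flatFun (n - 5) s), ?_, fun s => ?_⟩
    · exact flatSpan.smul_mem _ (flatSpan.add_mem (flatSpan.sub_mem
        (flatSpan.smul_mem _ (flatFun_mem_flatSpan _)) (flatFun_mem_flatSpan _))
        (flatFun_mem_flatSpan _))
    · simpa using hasDerivAt_flatFun_ofReal n s
  | zero => exact ⟨0, flatSpan.zero_mem, fun s => hasDerivAt_const s (0 : ℂ)⟩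
  | add f g _ _ hf hg =>
    obtain ⟨f', hf', hf⟩ := hf
    obtain ⟨g', hg', hg⟩ := hg
    exact ⟨f' + g', flatSpan.add_mem hf' hg', fun s => (hf s).add (hg s)⟩
  | smul a f _ hf =>
    obtain ⟨f', hf', hf⟩ := hf
    exact ⟨a • f', flatSpan.smul_mem a hf', fun s => (hf s).const_smul a⟩

lemma deriv_mem_flatSpan {f : ℝ → ℂ} (hf : f ∈ flatSpan) : deriv f ∈ flatSpan := by
  obtain ⟨f', hf', h⟩ := exists_hasDerivAt_of_mem_flatSpan hf
  rwa [show deriv f = f' from funext fun s => (h s).deriv]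

lemma iteratedDeriv_mem_flatSpan {f : ℝ → ℂ} (hf : f ∈ flatSpan) (n : ℕ) :
    iteratedDeriv n f ∈ flatSpan := by
  induction n with
  | zero => simpa using hf
  | succ n ih => rw [iteratedDeriv_succ]; exact deriv_mem_flatSpan ih

lemma contDiff_of_mem_flatSpan {f : ℝ → ℂ} (hf : f ∈ flatSpan) :
    ContDiff ℝ (⊤ : ℕ∞) f := by
  refine contDiff_of_differentiable_iteratedDeriv fun m _ s => ?_
  obtain ⟨f', -, h⟩ := exists_hasDerivAt_of_mem_flatSpan (iteratedDeriv_mem_flatSpan hf m)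
  exact (h s).differentiableAt

lemma apply_zero_of_mem_flatSpan {f : ℝ → ℂ} (hf : f ∈ flatSpan) : f 0 = 0 := by
  induction hf using Submodule.span_induction with
  | mem f h => obtain ⟨n, rfl⟩ := h; simp
  | zero => rfl
  | add f g _ _ hf hg => simp [hf, hg]
  | smul a f _ hf => simp [hf]

lemma exists_abs_pow_mul_norm_le_of_mem_flatSpan {f : ℝ → ℂ} (hf : f ∈ flatSpan) (m : ℕ) :
    ∃ C : ℝ, ∀ s : ℝ, |s| ^ m * ‖f s‖ ≤ C := by
  induction hf using Submodule.span_induction with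
  | mem f h =>
    obtain ⟨n, rfl⟩ := h
    obtain ⟨C, -, hC⟩ := exists_norm_flatFun_le (n + 4 * m)
    refine ⟨C, fun s => ?_⟩
    have h := norm_pow_mul_norm_flatFun m n s
    rw [Complex.norm_real, Real.norm_eq_abs] at h
    exact h.trans_le (hC s (by simp))
  | zero => exact ⟨0, fun s => by simp⟩
  | add f g _ _ hf hg =>
    obtain ⟨C, hC⟩ := hf
    obtain ⟨D, hD⟩ := hg
    refine ⟨C + D, fun s => ?_⟩
    calc |s| ^ m * ‖f s + g s‖ ≤ |s| ^ m * (‖f s‖ + ‖g s‖) := by gcongr; exact norm_add_le _ _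
      _ = |s| ^ m * ‖f s‖ + |s| ^ m * ‖g s‖ := mul_add _ _ _
      _ ≤ C + D := add_le_add (hC s) (hD s)
  | smul a f _ hf =>
    obtain ⟨C, hC⟩ := hf
    refine ⟨‖a‖ * C, fun s => ?_⟩
    calc |s| ^ m * ‖a • f s‖ = ‖a‖ * (|s| ^ m * ‖f s‖) := by rw [norm_smul]; ring
      _ ≤ ‖a‖ * C := by gcongr; exact hC s

lemma analyticOnNhd_flatFun (n : ℤ) : AnalyticOnNhd ℂ (flatFun n) {z : ℂ | z.im < 0} := by
  refine DifferentiableOn.analyticOnNhd (fun z hz => ?_)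
    (isOpen_lt Complex.continuous_im continuous_const)
  have hz' : z.im < 0 := hz
  have h0 : z ≠ 0 := by rintro rfl; simp at hz'
  exact (hasDerivAt_flatFun hz'.le h0 n).differentiableAt.differentiableWithinAt

lemma continuousOn_flatFun (n : ℤ) : ContinuousOn (flatFun n) {z : ℂ | z.im ≤ 0} := by
  intro z hz
  rcases eq_or_ne z 0 with rfl | h0
  · obtain ⟨C, hC⟩ := exists_norm_flatFun_le_norm_pow 1 n
    rw [ContinuousWithinAt, flatFun_zero]
    refine squeeze_zero_norm' (a := fun w => C * ‖w‖ ^ 1) ?_ ?_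
    · filter_upwards [self_mem_nhdsWithin] with w hw using hC w hw
    · have : Continuous fun w : ℂ => C * ‖w‖ ^ 1 := by fun_prop
      simpa using (this.tendsto 0).mono_left nhdsWithin_le_nhds
  · exact (hasDerivAt_flatFun hz h0 n).continuousAt.continuousWithinAt

lemma Rminus_lt_top_of_norm_le {f : ℂ → ℂ} {C D : ℝ}
    (hC : ∀ z : ℂ, z.im ≤ 0 → ‖f z‖ ≤ C) (hD : ∀ z : ℂ, z.im ≤ 0 → ‖z‖ * ‖f z‖ ≤ D) :
    Rminus f < ∞ := by
  have hint : Integrable (fun r : ℝ => (C ^ 2 + D ^ 2) * (1 + r ^ 2)⁻¹) :=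
    integrable_inv_one_add_sq.const_mul _
  refine lt_of_le_of_lt ?_ hint.hasFiniteIntegral
  refine iSup₂_le fun φ hφ => ?_
  refine le_trans ?_ (setLIntegral_le_lintegral (Ioi 0) _)
  refine setLIntegral_mono' measurableSet_Ioi fun r hr => ?_
  have hr : 0 < r := hr
  set z : ℂ := (r : ℂ) * Complex.exp ((φ : ℂ) * Complex.I) with hzdef
  have hz : z.im ≤ 0 := by
    rw [hzdef, Complex.im_ofReal_mul,
      Complex.exp_ofReal_mul_I_im]
    exact mul_nonpos_of_nonneg_of_nonpos hr.le
      (Real.sin_nonpos_of_nonpos_of_neg_pi_le hφ.2.le hφ.1.le)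
  have hn : ‖z‖ = r := by
    rw [hzdef, norm_mul, Complex.norm_exp_ofReal_mul_I, Complex.norm_real, Real.norm_eq_abs,
      abs_of_pos hr, mul_one]
  have h1 := hC z hz
  have h2 := hD z hz
  rw [hn] at h2
  have h3 : ‖f z‖ ^ 2 ≤ (C ^ 2 + D ^ 2) * (1 + r ^ 2)⁻¹ := by
    rw [← div_eq_mul_inv, le_div_iff₀ (by positivity)]
    have h4 : ‖f z‖ ^ 2 ≤ C ^ 2 := by gcongr
    have h5 : (r * ‖f z‖) ^ 2 ≤ D ^ 2 := by gcongr
    nlinarith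
  rw [← enorm_eq_nnnorm, ← ofReal_norm, ← ofReal_norm,
    ← ENNReal.ofReal_pow (norm_nonneg _)]
  exact ENNReal.ofReal_le_ofReal (h3.trans (le_abs_self _))

lemma Rminus_eq_top_of_one_le_norm {f : ℂ → ℂ} {φ R : ℝ} (hφ : φ ∈ Ioo (-Real.pi) 0) (hR : 0 ≤ R)
    (hf : ∀ r : ℝ, R < r → 1 ≤ ‖f ((r : ℂ) * Complex.exp ((φ : ℂ) * Complex.I))‖) :
    Rminus f = ∞ := by
  refine top_le_iff.1 (le_trans ?_ (le_iSup₂ (f := fun φ (_ : φ ∈ Ioo (-Real.pi) (0 : ℝ)) =>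
    ∫⁻ r in Ioi (0 : ℝ), (‖f ((r : ℂ) * Complex.exp ((φ : ℂ) * Complex.I))‖₊ : ℝ≥0∞) ^ 2) φ hφ))
  calc (⊤ : ℝ≥0∞) = ∫⁻ _ in Ioi R, 1 := by simp
    _ ≤ ∫⁻ r in Ioi R, (‖f ((r : ℂ) * Complex.exp ((φ : ℂ) * Complex.I))‖₊ : ℝ≥0∞) ^ 2 := by
      refine setLIntegral_mono' measurableSet_Ioi fun r hr => ?_
      have h : 1 ≤ ‖f ((r : ℂ) * Complex.exp ((φ : ℂ) * Complex.I))‖₊ := hf r hr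
      exact one_le_pow₀ (by exact_mod_cast h)
    _ ≤ _ := lintegral_mono_set (Ioi_subset_Ioi hR)

lemma one_le_norm_exp_mul_flatFun {b r : ℝ} (hb : 0 < b) (hr : (max 1 (4 / b)) ^ 4 < r) :
    1 ≤ ‖Complex.exp (Complex.I * (b : ℂ) *
      ((r : ℂ) * Complex.exp (((-(Real.pi / 2) : ℝ) : ℂ) * Complex.I)) ^ ((1 : ℂ) / 2)) *
      flatFun 0 ((r : ℂ) * Complex.exp (((-(Real.pi / 2) : ℝ) : ℂ) * Complex.I))‖ := by
  have hr0 : 0 < r := lt_trans (by positivity) hr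
  have hexp : Complex.exp (((-(Real.pi / 2) : ℝ) : ℂ) * Complex.I) = -Complex.I := by
    rw [Complex.exp_mul_I, ← Complex.ofReal_cos, ← Complex.ofReal_sin]
    simp
  rw [hexp]
  set z : ℂ := (r : ℂ) * -Complex.I with hz
  have hn : ‖z‖ = r := by simp [hz, abs_of_pos hr0]
  have h0 : z ≠ 0 := by rw [← norm_pos_iff, hn]; exact hr0
  set t : ℝ := r ^ (1 / 4 : ℝ) with ht
  have ht0 : 0 < t := Real.rpow_pos_of_pos hr0 _
  have ht4 : t ^ 4 = r := by
    rw [ht, ← Real.rpow_natCast, ← Real.rpow_mul hr0.le]; norm_num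
  have htmax : max 1 (4 / b) < t := by
    rw [← ht4] at hr
    exact lt_of_pow_lt_pow_left₀ 4 ht0.le hr
  have hroot : quarterRoot z = (t : ℂ) := by
    rw [quarterRoot, ht, Complex.ofReal_cpow hr0.le, hz]
    congr 1
    linear_combination (-(r : ℂ)) * Complex.I_sq
  have him : (z ^ ((1 : ℂ) / 2)).im = -(t ^ 2 * (Real.sqrt 2 / 2)) := by
    have h := Complex.cpow_ofReal_im z (1 / 2)
    push_cast at h
    rw [h, hn, hz, Complex.arg_real_mul _ hr0, Complex.arg_neg_I,
      show -(Real.pi / 2) * (1 / 2) = -(Real.pi / 4) by ring, Real.sin_neg, Real.sin_pi_div_four,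
      ht, ← Real.rpow_natCast, ← Real.rpow_mul hr0.le]
    norm_num
  rw [flatFun_of_ne h0, hroot, zpow_zero, one_mul, ← Complex.exp_add, Complex.norm_exp]
  apply Real.one_le_exp
  have hre : (Complex.I * (b : ℂ) * z ^ ((1 : ℂ) / 2) + -((t : ℂ) + (t : ℂ)⁻¹)).re =
      b * (t ^ 2 * (Real.sqrt 2 / 2)) - (t + t⁻¹) := by
    rw [← Complex.ofReal_inv, ← Complex.ofReal_add, Complex.add_re, Complex.neg_re,
      Complex.ofReal_re, mul_assoc, Complex.I_mul_re, Complex.im_ofReal_mul, him]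
    ring
  rw [hre]
  have ht1 : 1 < t := (le_max_left _ _).trans_lt htmax
  have hbt : 4 < t * b := (div_lt_iff₀ hb).1 ((le_max_right _ _).trans_lt htmax)
  have hinv : t⁻¹ ≤ t := (inv_le_one_of_one_le₀ ht1.le).trans ht1.le
  have hs : 1 ≤ Real.sqrt 2 := Real.one_le_sqrt.2 (by norm_num)
  have h1 : 2 * t ≤ b * (t ^ 2 * (1 / 2)) := by nlinarith
  have h2 : b * (t ^ 2 * (1 / 2)) ≤ b * (t ^ 2 * (Real.sqrt 2 / 2)) := by gcongr
  linarith

theorem stmt2 (b : ℝ) (hb : 0 < b) :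
    ∃ g : ℂ → ℂ,
      -- (i) analytic on the open lower half-plane, continuous on the closed lower half-plane
      AnalyticOnNhd ℂ g {z : ℂ | z.im < 0} ∧
      ContinuousOn g {z : ℂ | z.im ≤ 0} ∧
      -- (ii) the restriction to ℝ is a Schwartz function whose derivatives all vanish at 0
      ContDiff ℝ (⊤ : ℕ∞) (fun s : ℝ => g s) ∧
      (∀ m n : ℕ, ∃ C : ℝ, ∀ s : ℝ,
        |s| ^ m * ‖iteratedDeriv n (fun t : ℝ => g t) s‖ ≤ C) ∧
      (∀ n : ℕ, iteratedDeriv n (fun t : ℝ => g t) 0 = 0) ∧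
      -- (iii) radial Hardy bound from below
      Rminus g < ∞ ∧
      -- (iv) the multiplied function fails the radial Hardy bound from below
      Rminus (fun z : ℂ => Complex.exp (Complex.I * (b : ℂ) * z ^ ((1 : ℂ) / 2)) * g z) = ∞ := by
  obtain ⟨C, -, hC⟩ := exists_norm_flatFun_le 0
  obtain ⟨D, -, hD⟩ := exists_norm_flatFun_le (0 + 4 * (1 : ℕ))
  have hmem := flatFun_mem_flatSpan 0
  refine ⟨flatFun 0, analyticOnNhd_flatFun 0, continuousOn_flatFun 0,
    contDiff_of_mem_flatSpan hmem, fun m n =>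
      exists_abs_pow_mul_norm_le_of_mem_flatSpan (iteratedDeriv_mem_flatSpan hmem n) m,
    fun n => apply_zero_of_mem_flatSpan (iteratedDeriv_mem_flatSpan hmem n),
    Rminus_lt_top_of_norm_le hC (D := D) fun z hz => ?_, ?_⟩
  · rw [← pow_one ‖z‖, norm_pow_mul_norm_flatFun]
    exact hD z hz
  · have := Real.pi_pos
    exact Rminus_eq_top_of_one_le_norm (φ := -(Real.pi / 2)) (R := (max 1 (4 / b)) ^ 4)
      ⟨by linarith, by linarith⟩ (by positivity)
      fun r hr => one_le_norm_exp_mul_flatFun hb hr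
end

section
/- Let h : ℝ → ℂ be a Schwartz function with support contained in (0, ∞), and define f(z) = ∫₀^∞ exp(−i z x) h(x) dx for Im z ≤ 0. Then: (i) f is analytic on the open lower half-plane ℂ₋; (ii) f satisfies the horizontal Hardy bound from below with H₋(f) = sup_{y<0} ∫_ℝ |f(x'+iy)|² dx' ≤ 2π ∫_ℝ |h(x)|² dx; and (iii) if in addition all moments of h vanish, i.e. ∫₀^∞ x^n h(x) dx = 0 for every n ∈ ℕ, then every derivative of the restriction of f to ℝ vanishes at 0: (d^n/ds^n f)(0) = 0 for all n ∈ ℕ. -/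
open MeasureTheory Set
open scoped ENNReal

/-- Horizontal Hardy bound from below: `sup_{y<0} ∫_ℝ |f(x+iy)|² dx`. -/
noncomputable def Hminus (f : ℂ → ℂ) : ℝ≥0∞ :=
  ⨆ y ∈ Set.Iio (0 : ℝ),
    ∫⁻ x : ℝ, (‖f ((x : ℂ) + (y : ℂ) * Complex.I)‖₊ : ℝ≥0∞) ^ 2

open FourierTransform Filter Topology

theorem SchwartzMap.integrable_norm_sq (g : SchwartzMap ℝ ℂ) : Integrable fun x => ‖g x‖ ^ 2 :=
  (memLp_two_iff_integrable_sq_norm g.continuous.aestronglyMeasurable).1 (g.memLp 2)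

/-- Plancherel's theorem with the angular frequency normalization. -/
theorem SchwartzMap.lintegral_sq_fourier_div_two_pi (g : SchwartzMap ℝ ℂ) :
    ∫⁻ x : ℝ, (‖𝓕 g (x / (2 * Real.pi))‖₊ : ℝ≥0∞) ^ 2 =
      ENNReal.ofReal (2 * Real.pi) * ∫⁻ x : ℝ, (‖g x‖₊ : ℝ≥0∞) ^ 2 := by
  have key (u : ℝ → ℂ) (hu : Integrable fun x => ‖u x‖ ^ 2) :
      ∫⁻ x : ℝ, (‖u x‖₊ : ℝ≥0∞) ^ 2 = ENNReal.ofReal (∫ x, ‖u x‖ ^ 2) := by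
    rw [ofReal_integral_eq_lintegral_ofReal hu (ae_of_all _ fun x => sq_nonneg _)]
    refine lintegral_congr fun x => ?_
    rw [ENNReal.ofReal_pow (norm_nonneg _), ofReal_norm, enorm_eq_nnnorm]
  have hint := (𝓕 g).integrable_norm_sq
  rw [key g g.integrable_norm_sq, key _ (hint.comp_div Real.two_pi_pos.ne'),
    Measure.integral_comp_div (fun x => ‖𝓕 g x‖ ^ 2), SchwartzMap.integral_norm_sq_fourier,
    abs_of_pos Real.two_pi_pos, smul_eq_mul, ENNReal.ofReal_mul Real.two_pi_pos.le]

theorem Real.fourier_div_two_pi (g : ℝ → ℂ) (x : ℝ) :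
    𝓕 g (x / (2 * Real.pi)) = ∫ v : ℝ, Complex.exp (-(Complex.I * x * v)) * g v := by
  rw [Real.fourier_real_eq_integral_exp_smul]
  refine integral_congr_ae (ae_of_all _ fun v => ?_)
  have : (Real.pi : ℂ) ≠ 0 := by exact_mod_cast Real.pi_ne_zero
  simp only [smul_eq_mul]
  congr 2
  push_cast
  field_simp

theorem norm_exp_neg_I_mul_le_one {z : ℂ} (hz : z.im ≤ 0) {x : ℝ} (hx : 0 ≤ x) :
    ‖Complex.exp (-(Complex.I * z * x))‖ ≤ 1 := by
  rw [Complex.norm_exp, Real.exp_le_one_iff]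
  simpa using mul_nonpos_of_nonpos_of_nonneg hz hx

theorem hasDerivAt_integral_exp_mul (h : SchwartzMap ℝ ℂ) {z : ℂ} (hz : z.im < 0) :
    HasDerivAt (fun w : ℂ => ∫ x in Ioi (0 : ℝ), Complex.exp (-(Complex.I * w * x)) * h x)
      (∫ x in Ioi (0 : ℝ), Complex.exp (-(Complex.I * z * x)) * -(Complex.I * x) * h x) z := by
  have hs : {w : ℂ | w.im < 0} ∈ 𝓝 z :=
    (isOpen_lt Complex.continuous_im continuous_const).mem_nhds hz
  refine (hasDerivAt_integral_of_dominated_loc_of_deriv_le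
    (F := fun w (x : ℝ) => Complex.exp (-(Complex.I * w * x)) * h x)
    (F' := fun w (x : ℝ) => Complex.exp (-(Complex.I * w * x)) * -(Complex.I * x) * h x)
    (bound := fun x => ‖x‖ ^ 1 * ‖h x‖) hs ?_ ?_ ?_ ?_
    (h.integrable_pow_mul volume 1).integrableOn ?_).2
  · exact Eventually.of_forall fun w => by fun_prop
  · refine h.integrable.restrict.mono (by fun_prop)
      ((ae_restrict_iff' measurableSet_Ioi).2 (ae_of_all _ fun x hx => ?_))
    rw [norm_mul]
    exact mul_le_of_le_one_left (norm_nonneg _)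
      (norm_exp_neg_I_mul_le_one hz.le (le_of_lt hx))
  · fun_prop
  · refine (ae_restrict_iff' measurableSet_Ioi).2 (ae_of_all _ fun x hx w hw => ?_)
    rw [norm_mul, norm_mul]
    gcongr
    simpa using mul_le_of_le_one_left (abs_nonneg x)
      (norm_exp_neg_I_mul_le_one (le_of_lt hw) (le_of_lt hx))
  · refine ae_of_all _ fun x w _ => ?_
    have : HasDerivAt (fun w : ℂ => -(Complex.I * w * x)) (-(Complex.I * x)) w := by
      simpa using (((hasDerivAt_id w).const_mul Complex.I).mul_const (x : ℂ)).fun_neg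
    exact this.cexp.mul_const _

theorem lintegral_sq_integral_exp_mul_le (h : SchwartzMap ℝ ℂ)
    (hsupp : Function.support h ⊆ Ioi 0) {y : ℝ} (hy : y ≤ 0) :
    ∫⁻ x : ℝ, (‖∫ v : ℝ, Complex.exp (-(Complex.I * (x + y * Complex.I) * v)) * h v‖₊ : ℝ≥0∞) ^ 2 ≤
      ENNReal.ofReal (2 * Real.pi) * ∫⁻ x : ℝ, (‖h x‖₊ : ℝ≥0∞) ^ 2 := by
  let φ (n : ℕ) : ContDiffBump (0 : ℝ) := ⟨n + 1, n + 2, by positivity, by linarith⟩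
  have hφ (v : ℝ) : ∀ᶠ n in atTop, φ n v = 1 := by
    filter_upwards [eventually_ge_atTop ⌈|v|⌉₊] with n hn
    apply (φ n).one_of_mem_closedBall
    rw [mem_closedBall_zero_iff, Real.norm_eq_abs]
    exact (Nat.ceil_le.1 hn).trans (le_add_of_nonneg_right zero_le_one)
  let u (n : ℕ) (v : ℝ) : ℂ := φ n v * (Complex.exp (y * v) * h v)
  have hu_compact (n : ℕ) : HasCompactSupport (u n) :=
    ((φ n).hasCompactSupport.comp_left (g := ((↑) : ℝ → ℂ)) Complex.ofReal_zero).mul_right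
  have hu_smooth (n : ℕ) : ContDiff ℝ (⊤ : ℕ∞) (u n) := by
    have h1 : ContDiff ℝ (⊤ : ℕ∞) fun v : ℝ => (v : ℂ) := Complex.ofRealCLM.contDiff
    exact (h1.comp (φ n).contDiff).mul ((contDiff_const.mul h1).cexp.mul h.smooth')
  let g (n : ℕ) : SchwartzMap ℝ ℂ := (hu_compact n).toSchwartzMap (hu_smooth n)
  have hg (n : ℕ) (v : ℝ) : g n v = φ n v * (Complex.exp (y * v) * h v) := rfl
  have hg_le (n : ℕ) (v : ℝ) : ‖g n v‖ ≤ ‖h v‖ := by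
    rw [hg]
    by_cases hv : h v = 0
    · simp [hv]
    have hexp : ‖Complex.exp (y * v)‖ ≤ 1 := by
      rw [Complex.norm_exp, Real.exp_le_one_iff]
      simpa using mul_nonpos_of_nonpos_of_nonneg hy (le_of_lt (hsupp hv))
    rw [norm_mul, norm_mul, Complex.norm_real, Real.norm_of_nonneg (φ n).nonneg]
    exact (mul_le_of_le_one_left (by positivity) (φ n).le_one).trans
      (mul_le_of_le_one_left (norm_nonneg _) hexp)
  have hlim (x : ℝ) : Tendsto (fun n => 𝓕 (g n) (x / (2 * Real.pi))) atTop
      (𝓝 (∫ v : ℝ, Complex.exp (-(Complex.I * (x + y * Complex.I) * v)) * h v)) := by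
    simp_rw [SchwartzMap.fourier_coe, Real.fourier_div_two_pi]
    refine tendsto_integral_of_dominated_convergence (fun v => ‖h v‖)
      (fun n => ?_) h.integrable.norm (fun n => ae_of_all _ fun v => ?_)
      (ae_of_all _ fun v => ?_)
    · have := (g n).continuous
      fun_prop
    · rw [norm_mul, Complex.norm_exp]
      simpa using hg_le n v
    · refine tendsto_const_nhds.congr' ((hφ v).mono fun n hn => ?_)
      beta_reduce
      rw [hg, hn, Complex.ofReal_one, one_mul, ← mul_assoc, ← Complex.exp_add]
      congr 2
      linear_combination (-(y * v) : ℂ) * Complex.I_sq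
  calc _ = ∫⁻ x : ℝ, liminf (fun n => (‖𝓕 (g n) (x / (2 * Real.pi))‖₊ : ℝ≥0∞) ^ 2) atTop := by
        refine lintegral_congr fun x => (Tendsto.liminf_eq ?_).symm
        exact ((ENNReal.continuous_pow 2).tendsto _).comp
          (ENNReal.tendsto_coe.2 (hlim x).nnnorm)
    _ ≤ liminf (fun n => ∫⁻ x : ℝ, (‖𝓕 (g n) (x / (2 * Real.pi))‖₊ : ℝ≥0∞) ^ 2) atTop := by
        refine lintegral_liminf_le fun n => ?_
        have := (𝓕 (g n)).continuous
        fun_prop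
    _ ≤ _ := by
        refine liminf_le_of_frequently_le' (Frequently.of_forall fun n => ?_)
        rw [SchwartzMap.lintegral_sq_fourier_div_two_pi]
        gcongr with v
        exact hg_le n v

theorem iteratedDeriv_integral_exp_mul_zero (h : SchwartzMap ℝ ℂ) (n : ℕ) :
    iteratedDeriv n (fun s : ℝ => ∫ v : ℝ, Complex.exp (-(Complex.I * s * v)) * h v) 0 =
      (-Complex.I) ^ n * ∫ v : ℝ, (v : ℂ) ^ n * h v := by
  have hF : (fun s : ℝ => ∫ v : ℝ, Complex.exp (-(Complex.I * s * v)) * h v) =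
      fun s => 𝓕 (h : ℝ → ℂ) ((2 * Real.pi)⁻¹ * s) := by
    ext s
    rw [← Real.fourier_div_two_pi, div_eq_inv_mul]
  have hsmooth : ContDiff ℝ n (𝓕 (h : ℝ → ℂ)) := (𝓕 h).smooth n
  have hint (k : ℕ) (_ : (k : ℕ∞) ≤ n) : Integrable fun x : ℝ => x ^ k • h x :=
    (h.integrable_pow_mul volume k).mono (by have := h.continuous; fun_prop)
      (ae_of_all _ fun x => by simp)
  have hpi : (Real.pi : ℂ) ≠ 0 := by exact_mod_cast Real.pi_ne_zero
  rw [hF, iteratedDeriv_comp_const_smul hsmooth, Real.iteratedDeriv_fourier hint le_rfl]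
  beta_reduce
  rw [mul_zero, Real.fourier_real_eq_integral_exp_smul, ← integral_smul, ← integral_const_mul]
  refine integral_congr_ae (ae_of_all _ fun v => ?_)
  simp only [mul_zero, Complex.ofReal_zero, zero_mul, Complex.exp_zero, one_mul, smul_eq_mul,
    Complex.real_smul, Complex.ofReal_pow]
  rw [← mul_assoc, ← mul_assoc, ← mul_pow, ← mul_pow]
  congr 2
  push_cast
  field_simp

theorem stmt7 (h : SchwartzMap ℝ ℂ) (hsupp : Function.support ⇑h ⊆ Set.Ioi (0 : ℝ))
    (f : ℂ → ℂ)
    (hf : ∀ z : ℂ, f z = ∫ x in Set.Ioi (0 : ℝ), Complex.exp (-(Complex.I * z * (x : ℂ))) * h x) :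
    -- (i) analytic on the open lower half-plane
    AnalyticOnNhd ℂ f {z : ℂ | z.im < 0} ∧
    -- (ii) horizontal Hardy bound from below, with `H₋(f) ≤ 2π ∫ |h|²`
    Hminus f ≤ ENNReal.ofReal (2 * Real.pi) * ∫⁻ x : ℝ, (‖h x‖₊ : ℝ≥0∞) ^ 2 ∧
    -- (iii) if all moments of `h` vanish, all derivatives of `f|_ℝ` vanish at 0
    ((∀ n : ℕ, ∫ x in Set.Ioi (0 : ℝ), (x : ℂ) ^ n * h x = 0) →
      ∀ n : ℕ, iteratedDeriv n (fun s : ℝ => f s) 0 = 0) := by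
  have hzero (v : ℝ) (hv : v ∉ Ioi (0 : ℝ)) : h v = 0 := by
    by_contra hne
    exact hv (hsupp hne)
  have hf_full (z : ℂ) : f z = ∫ v : ℝ, Complex.exp (-(Complex.I * z * v)) * h v := by
    rw [hf, setIntegral_eq_integral_of_forall_compl_eq_zero fun v hv => by simp [hzero v hv]]
  refine ⟨?_, ?_, fun hmom n => ?_⟩
  · refine DifferentiableOn.analyticOnNhd (fun z hz => ?_)
      (isOpen_lt Complex.continuous_im continuous_const)
    rw [funext hf]
    exact (hasDerivAt_integral_exp_mul h hz).differentiableAt.differentiableWithinAt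
  · refine iSup₂_le fun y hy => ?_
    simp_rw [hf_full]
    exact lintegral_sq_integral_exp_mul_le h hsupp (le_of_lt hy)
  · simp_rw [hf_full]
    rw [iteratedDeriv_integral_exp_mul_zero,
      ← setIntegral_eq_integral_of_forall_compl_eq_zero (s := Ioi (0 : ℝ))
        fun v hv => by simp [hzero v hv], hmom, mul_zero]
end

section
/- Fix b ≥ 0 and let E_b : ℝ → ℂ be defined by E_b(s) = exp(−i b √s) for s ≥ 0 and E_b(s) = exp(−b √(−s)) for s < 0. For every N ∈ ℕ there exist a constant C > 0 and M ∈ ℕ (both possibly depending on b and N) such that for every smooth function f : ℝ → ℂ with ‖f‖_K < ∞ for all K ∈ ℕ, the weighted derivative bound sup_{s∈ℝ, s≠0} sup_{n≤N} (|s| + 1/|s|)^N |(d^n/ds^n)(E_b · f)(s)| ≤ C ‖f‖_M holds, where derivatives of E_b · f are taken on ℝ \ {0}. -/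
open Set

/-- The boundary value on ℝ (from the lower half-plane) of `z ↦ exp(−i b z^{1/2})`:
`E_b(s) = exp(−i b √s)` for `s ≥ 0` and `E_b(s) = exp(−b √(−s))` for `s < 0`. -/
noncomputable def Eb (b : ℝ) (s : ℝ) : ℂ :=
  if 0 ≤ s then Complex.exp (-(Complex.I * (b : ℂ) * (Real.sqrt s : ℂ)))
  else Complex.exp (-((b : ℂ) * (Real.sqrt (-s) : ℂ)))

/-- The weighted norm `‖f‖_K = sup_{s≠0} sup_{n≤K} (|s| + 1/|s|)^K |f⁽ⁿ⁾(s)|`. -/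
noncomputable def wnorm (K : ℕ) (f : ℝ → ℂ) : ℝ :=
  sSup {c : ℝ | ∃ s : ℝ, s ≠ 0 ∧ ∃ n : ℕ, n ≤ K ∧
    c = (|s| + 1 / |s|) ^ K * ‖iteratedDeriv n f s‖}

/-- `F` is `C^n` away from `0`, and its derivatives up to order `n` grow at most like a power of
`|s| + 1 / |s|`. -/
def PolyBounded (n : ℕ) (F : ℝ → ℂ) : Prop :=
  ContDiffOn ℝ n F {x : ℝ | x ≠ 0} ∧ ∃ C : ℝ, 0 ≤ C ∧ ∃ k : ℕ, ∀ m ≤ n, ∀ s : ℝ, s ≠ 0 →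
    ‖iteratedDerivWithin m F {x : ℝ | x ≠ 0} s‖ ≤ C * (|s| + 1 / |s|) ^ k

theorem one_le_abs_add_one_div_abs {s : ℝ} (hs : s ≠ 0) : 1 ≤ |s| + 1 / |s| := by
  have h : 0 < |s| := abs_pos.mpr hs
  rcases le_total 1 |s| with h1 | h1
  · have : 0 < 1 / |s| := by positivity
    linarith
  · have : 1 ≤ 1 / |s| := (one_le_div h).mpr h1
    linarith

theorem isOpen_setOf_ne_zero : IsOpen {x : ℝ | x ≠ 0} := isOpen_ne

/-- A pointwise Leibniz bound. -/
theorem norm_iteratedDerivWithin_mul_le_two_pow {S : Set ℝ} (hS : UniqueDiffOn ℝ S)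
    {F G : ℝ → ℂ} {n : ℕ} (hF : ContDiffOn ℝ n F S) (hG : ContDiffOn ℝ n G S)
    {s : ℝ} (hs : s ∈ S) {A B : ℝ}
    (hA : ∀ m ≤ n, ‖iteratedDerivWithin m F S s‖ ≤ A)
    (hB : ∀ m ≤ n, ‖iteratedDerivWithin m G S s‖ ≤ B) :
    ‖iteratedDerivWithin n (fun t => F t * G t) S s‖ ≤ 2 ^ n * (A * B) := by
  have hA0 : 0 ≤ A := (norm_nonneg _).trans (hA 0 (Nat.zero_le _))
  have h := norm_iteratedFDerivWithin_mul_le hF hG hS hs (n := n) le_rfl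
  simp only [norm_iteratedFDerivWithin_eq_norm_iteratedDerivWithin] at h
  refine h.trans ?_
  calc _ ≤ ∑ i ∈ Finset.range (n + 1), (n.choose i : ℝ) * (A * B) := by
        refine Finset.sum_le_sum fun i hi => ?_
        rw [mul_assoc]
        have hi' : i ≤ n := Nat.lt_succ_iff.mp (Finset.mem_range.mp hi)
        gcongr
        · exact hA i hi'
        · exact hB _ (Nat.sub_le _ _)
    _ = 2 ^ n * (A * B) := by
        rw [← Finset.sum_mul]
        congr 1
        exact_mod_cast Nat.sum_range_choose n

/-- The logarithmic derivative controls growth. -/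
theorem PolyBounded.succ_of_hasDerivAt {n : ℕ} {F G : ℝ → ℂ} (hF : PolyBounded n F)
    (hG : PolyBounded n G) (h : ∀ s : ℝ, s ≠ 0 → HasDerivAt F (G s * F s) s) :
    PolyBounded (n + 1) F := by
  obtain ⟨hFc, A, hA, k, hFb⟩ := hF
  obtain ⟨hGc, B, hB, l, hGb⟩ := hG
  have hu : UniqueDiffOn ℝ {x : ℝ | x ≠ 0} := isOpen_setOf_ne_zero.uniqueDiffOn
  have hd : EqOn (derivWithin F {x : ℝ | x ≠ 0}) (fun t => G t * F t) {x : ℝ | x ≠ 0} :=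
    fun s hs => ((h s hs).hasDerivWithinAt).derivWithin (hu s hs)
  refine ⟨?_, A + 2 ^ n * (B * A), by positivity, k + (l + k), ?_⟩
  · rw [Nat.cast_add, Nat.cast_one, contDiffOn_succ_iff_derivWithin hu]
    refine ⟨fun s hs => (h s hs).differentiableAt.differentiableWithinAt, by simp, ?_⟩
    exact (hGc.mul hFc).congr hd
  · intro m hm s hs
    have hw := one_le_abs_add_one_div_abs hs
    set w := |s| + 1 / |s| with hwdef
    have hw0 : 0 ≤ w := by linarith
    rcases m with _ | m
    · calc _ ≤ A * w ^ k := hFb 0 (Nat.zero_le _) s hs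
        _ ≤ (A + 2 ^ n * (B * A)) * w ^ (k + (l + k)) := by
          refine mul_le_mul ?_ (pow_le_pow_right₀ hw (by omega)) (by positivity) (by positivity)
          have : 0 ≤ 2 ^ n * (B * A) := by positivity
          linarith
    · have hmn : m ≤ n := by omega
      rw [iteratedDerivWithin_succ', iteratedDerivWithin_congr hd hs]
      have hle : (m : WithTop ℕ∞) ≤ n := by exact_mod_cast hmn
      have := norm_iteratedDerivWithin_mul_le_two_pow hu (hGc.of_le hle) (hFc.of_le hle) hs
        (fun j hj => hGb j (hj.trans hmn) s hs) (fun j hj => hFb j (hj.trans hmn) s hs)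
      refine this.trans ?_
      rw [← hwdef]
      calc (2 : ℝ) ^ m * (B * w ^ l * (A * w ^ k)) = 2 ^ m * (B * A) * w ^ (l + k) := by ring
        _ ≤ (A + 2 ^ n * (B * A)) * w ^ (k + (l + k)) := by
          refine mul_le_mul ?_ (pow_le_pow_right₀ hw (by omega)) (by positivity) (by positivity)
          have : (2 : ℝ) ^ m * (B * A) ≤ 2 ^ n * (B * A) := by
            gcongr
            norm_num
          linarith

theorem polyBounded_zero {F : ℝ → ℂ} (hc : ContinuousOn F {x : ℝ | x ≠ 0}) {C : ℝ} (hC : 0 ≤ C)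
    (k : ℕ) (h : ∀ s : ℝ, s ≠ 0 → ‖F s‖ ≤ C * (|s| + 1 / |s|) ^ k) : PolyBounded 0 F := by
  refine ⟨by simpa using hc, C, hC, k, fun m hm s hs => ?_⟩
  obtain rfl : m = 0 := by omega
  simpa using h s hs

theorem PolyBounded.of_hasDerivAt {F G : ℝ → ℂ} (hF : PolyBounded 0 F)
    (hG : ∀ n, PolyBounded n G) (h : ∀ s : ℝ, s ≠ 0 → HasDerivAt F (G s * F s) s) (n : ℕ) :
    PolyBounded n F := by
  induction n with
  | zero => exact hF
  | succ n ih => exact ih.succ_of_hasDerivAt (hG n) h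

theorem continuousOn_of_hasDerivAt_of_ne_zero {F F' : ℝ → ℂ}
    (h : ∀ s : ℝ, s ≠ 0 → HasDerivAt F (F' s) s) : ContinuousOn F {x : ℝ | x ≠ 0} :=
  fun s hs => (h s hs).continuousAt.continuousWithinAt

theorem hasDerivAt_const_mul_ofReal_inv (c : ℂ) {s : ℝ} (hs : s ≠ 0) :
    HasDerivAt (fun t : ℝ => c * ((t⁻¹ : ℝ) : ℂ)) (-(s⁻¹ : ℝ) * (c * ((s⁻¹ : ℝ) : ℂ))) s := by
  refine (((hasDerivAt_inv hs).ofReal_comp).const_mul c).congr_deriv ?_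
  push_cast
  ring

theorem polyBounded_const_mul_inv (c : ℂ) (n : ℕ) :
    PolyBounded n (fun t : ℝ => c * ((t⁻¹ : ℝ) : ℂ)) := by
  have h0 (c : ℂ) : PolyBounded 0 (fun t : ℝ => c * ((t⁻¹ : ℝ) : ℂ)) := by
    refine polyBounded_zero (continuousOn_of_hasDerivAt_of_ne_zero
      fun s hs => hasDerivAt_const_mul_ofReal_inv c hs) (norm_nonneg c) 1 fun s hs => ?_
    rw [norm_mul, Complex.norm_real, Real.norm_eq_abs, abs_inv, pow_one]
    gcongr
    rw [one_div]
    linarith [abs_nonneg s]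
  have h1 (n : ℕ) : PolyBounded n (fun t : ℝ => (-1 : ℂ) * ((t⁻¹ : ℝ) : ℂ)) := by
    induction n with
    | zero => exact h0 _
    | succ n ih =>
      refine ih.succ_of_hasDerivAt ih fun s hs => ?_
      simpa only [neg_one_mul] using hasDerivAt_const_mul_ofReal_inv (-1) hs
  refine (h0 c).of_hasDerivAt h1 (fun s hs => ?_) n
  simpa only [neg_one_mul] using hasDerivAt_const_mul_ofReal_inv c hs

/-- The logarithmic derivative of `Eb b`. -/
noncomputable def EbLogDeriv (b s : ℝ) : ℂ :=
  if 0 ≤ s then -(Complex.I * b) / 2 * (((√s)⁻¹ : ℝ) : ℂ) else b / 2 * (((√(-s))⁻¹ : ℝ) : ℂ)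

theorem hasDerivAt_Eb (b : ℝ) {s : ℝ} (hs : s ≠ 0) :
    HasDerivAt (Eb b) (EbLogDeriv b s * Eb b s) s := by
  rcases lt_or_gt_of_ne hs with h | h
  · have he : Eb b =ᶠ[nhds s] fun t => Complex.exp (-((b : ℂ) * (√(-t) : ℂ))) := by
      filter_upwards [gt_mem_nhds h] with t ht
      simp [Eb, not_le.mpr ht]
    refine HasDerivAt.congr_of_eventuallyEq ?_ he
    have h1 := (((hasDerivAt_neg s).sqrt (by simpa using hs)).ofReal_comp.const_mul
      (b : ℂ)).neg.cexp
    refine h1.congr_deriv ?_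
    simp only [EbLogDeriv, Eb, Pi.neg_apply, not_le.mpr h, if_false]
    push_cast
    field_simp
  · have he : Eb b =ᶠ[nhds s] fun t => Complex.exp (-(Complex.I * (b : ℂ) * (√t : ℂ))) := by
      filter_upwards [lt_mem_nhds h] with t ht
      simp [Eb, le_of_lt ht]
    refine HasDerivAt.congr_of_eventuallyEq ?_ he
    have h1 := (((hasDerivAt_id s).sqrt hs).ofReal_comp.const_mul
      (Complex.I * (b : ℂ))).neg.cexp
    refine h1.congr_deriv ?_
    simp only [EbLogDeriv, Eb, Pi.neg_apply, h.le, if_true, id]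
    push_cast
    field_simp

theorem hasDerivAt_EbLogDeriv (b : ℝ) {s : ℝ} (hs : s ≠ 0) :
    HasDerivAt (EbLogDeriv b) (-1 / 2 * ((s⁻¹ : ℝ) : ℂ) * EbLogDeriv b s) s := by
  rcases lt_or_gt_of_ne hs with h | h
  · have he : EbLogDeriv b =ᶠ[nhds s] fun t => b / 2 * (((√(-t))⁻¹ : ℝ) : ℂ) := by
      filter_upwards [gt_mem_nhds h] with t ht
      simp [EbLogDeriv, not_le.mpr ht]
    refine HasDerivAt.congr_of_eventuallyEq ?_ he
    have h0 : 0 < √(-s) := Real.sqrt_pos.mpr (by linarith)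
    have h1 := (((hasDerivAt_neg s).sqrt (by simpa using hs)).inv
      h0.ne').ofReal_comp.const_mul ((b : ℂ) / 2)
    refine h1.congr_deriv ?_
    simp only [EbLogDeriv, not_le.mpr h, if_false]
    have hr : -1 / 2 * s⁻¹ * (√(-s))⁻¹ = -(-1 / (2 * √(-s))) / √(-s) ^ 2 := by
      rw [Real.sq_sqrt (by linarith)]
      field_simp
    rw [← hr]
    push_cast
    ring
  · have he : EbLogDeriv b =ᶠ[nhds s] fun t => -(Complex.I * b) / 2 * (((√t)⁻¹ : ℝ) : ℂ) := by
      filter_upwards [lt_mem_nhds h] with t ht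
      simp [EbLogDeriv, le_of_lt ht]
    refine HasDerivAt.congr_of_eventuallyEq ?_ he
    have h0 : 0 < √s := Real.sqrt_pos.mpr h
    have h1 := (((hasDerivAt_id s).sqrt hs).inv
      h0.ne').ofReal_comp.const_mul (-(Complex.I * b) / 2)
    refine h1.congr_deriv ?_
    simp only [EbLogDeriv, h.le, if_true, id]
    have hr : -1 / 2 * s⁻¹ * (√s)⁻¹ = -(1 / (2 * √s)) / √s ^ 2 := by
      rw [Real.sq_sqrt h.le]
      field_simp
    rw [← hr]
    push_cast
    ring

theorem norm_EbLogDeriv (b s : ℝ) : ‖EbLogDeriv b s‖ = |b| / 2 * (√|s|)⁻¹ := by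
  unfold EbLogDeriv
  split_ifs with h
  · simp [abs_of_nonneg h, abs_of_nonneg (Real.sqrt_nonneg s)]
  · simp [abs_of_neg (not_le.mp h), abs_of_nonneg (Real.sqrt_nonneg (-s))]

theorem norm_Eb_le_one {b : ℝ} (hb : 0 ≤ b) (s : ℝ) : ‖Eb b s‖ ≤ 1 := by
  unfold Eb
  split_ifs
  · simp [Complex.norm_exp]
  · simp only [Complex.norm_exp, Real.exp_le_one_iff]
    simpa using mul_nonneg hb (Real.sqrt_nonneg (-s))

theorem inv_sqrt_abs_le {s : ℝ} (hs : s ≠ 0) : (√|s|)⁻¹ ≤ |s| + 1 / |s| := by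
  have h : 0 < |s| := abs_pos.mpr hs
  have h0 : 0 < √|s| := Real.sqrt_pos.mpr h
  rcases le_total 1 |s| with h1 | h1
  · have : (√|s|)⁻¹ ≤ 1 := inv_le_one_of_one_le₀ (Real.one_le_sqrt.mpr h1)
    exact this.trans (one_le_abs_add_one_div_abs hs)
  · have : |s| ≤ √|s| := Real.le_sqrt_of_sq_le (by nlinarith)
    have : (√|s|)⁻¹ ≤ |s|⁻¹ := inv_anti₀ h this
    rw [one_div]
    linarith

theorem polyBounded_EbLogDeriv (b : ℝ) (n : ℕ) : PolyBounded n (EbLogDeriv b) := by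
  refine PolyBounded.of_hasDerivAt (polyBounded_zero (continuousOn_of_hasDerivAt_of_ne_zero
    fun s hs => hasDerivAt_EbLogDeriv b hs) (C := |b| / 2) (by positivity) 1 fun s hs => ?_)
    (polyBounded_const_mul_inv (-1 / 2)) (fun s hs => hasDerivAt_EbLogDeriv b hs) n
  rw [norm_EbLogDeriv, pow_one]
  gcongr
  exact inv_sqrt_abs_le hs

theorem polyBounded_Eb {b : ℝ} (hb : 0 ≤ b) (n : ℕ) : PolyBounded n (Eb b) := by
  refine PolyBounded.of_hasDerivAt (polyBounded_zero (continuousOn_of_hasDerivAt_of_ne_zero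
    fun s hs => hasDerivAt_Eb b hs) zero_le_one 0 fun s _ => ?_)
    (polyBounded_EbLogDeriv b) (fun s hs => hasDerivAt_Eb b hs) n
  simpa using norm_Eb_le_one hb s

theorem stmt8 (b : ℝ) (hb : 0 ≤ b) (N : ℕ) :
    ∃ C : ℝ, 0 < C ∧ ∃ M : ℕ,
      ∀ f : ℝ → ℂ, ContDiff ℝ (⊤ : ℕ∞) f →
        (∀ K : ℕ, BddAbove {c : ℝ | ∃ s : ℝ, s ≠ 0 ∧ ∃ n : ℕ, n ≤ K ∧
          c = (|s| + 1 / |s|) ^ K * ‖iteratedDeriv n f s‖}) →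
        ∀ s : ℝ, s ≠ 0 → ∀ n : ℕ, n ≤ N →
          (|s| + 1 / |s|) ^ N *
            ‖iteratedDerivWithin n (fun t : ℝ => Eb b t * f t) {x : ℝ | x ≠ 0} s‖
          ≤ C * wnorm M f := by
  obtain ⟨hEc, A, hA, k, hE⟩ := polyBounded_Eb hb N
  refine ⟨2 ^ N * A + 1, by positivity, N + k, fun f hf hbdd s hs n hn => ?_⟩
  have hw := one_le_abs_add_one_div_abs hs
  set w := |s| + 1 / |s| with hwdef
  have hw0 : 0 < w := by linarith
  have hu : UniqueDiffOn ℝ {x : ℝ | x ≠ 0} := isOpen_setOf_ne_zero.uniqueDiffOn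
  have hle : (n : WithTop ℕ∞) ≤ N := by exact_mod_cast hn
  have hfW : ∀ m ≤ n, ‖iteratedDerivWithin m f {x : ℝ | x ≠ 0} s‖
      ≤ wnorm (N + k) f / w ^ (N + k) := by
    intro m hm
    rw [iteratedDerivWithin_of_isOpen isOpen_setOf_ne_zero hs, le_div_iff₀ (by positivity),
      mul_comm]
    exact le_csSup (hbdd (N + k)) ⟨s, hs, m, by omega, rfl⟩
  have hW : 0 ≤ wnorm (N + k) f := by
    have := (norm_nonneg _).trans (hfW 0 (Nat.zero_le _))
    rwa [le_div_iff₀ (by positivity), zero_mul] at this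
  have hmul := norm_iteratedDerivWithin_mul_le_two_pow hu (hEc.of_le hle)
    ((hf.of_le (by exact_mod_cast le_top)).contDiffOn) hs
    (fun m hm => hE m (hm.trans hn) s hs) hfW
  calc _ ≤ w ^ N * (2 ^ n * (A * w ^ k * (wnorm (N + k) f / w ^ (N + k)))) := by gcongr
    _ = 2 ^ n * A * wnorm (N + k) f := by
      rw [pow_add]
      field_simp
    _ ≤ (2 ^ N * A + 1) * wnorm (N + k) f := by
      gcongr
      have : (2 : ℝ) ^ n * A ≤ 2 ^ N * A := by
        gcongr
        norm_num
      linarith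
end

section
/- Let 𝒜 be the class of functions f : ℂ → ℂ such that: f is analytic on the open lower half-plane ℂ₋ and continuous on the closed lower half-plane {z : Im z ≤ 0}; the restriction of f to ℝ is a Schwartz function all of whose derivatives vanish at 0; and f satisfies the radial Hardy bound from below R₋(f) = sup_{−π<φ<0} ∫₀^∞ |f(r e^{iφ})|² dr < ∞. Then for b ∈ ℝ the following are equivalent: (1) for every f ∈ 𝒜 the function z ↦ exp(−i b z^{1/2}) f(z) (principal square root) satisfies the radial Hardy bound from below, sup_{−π<φ<0} ∫₀^∞ |exp(−i b (r e^{iφ})^{1/2}) f(r e^{iφ})|² dr < ∞; (2) b ≥ 0. -/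
open MeasureTheory Set
open scoped ENNReal

/-- The class `𝒜`: functions analytic on the open lower half-plane, continuous on the closed
lower half-plane, whose restriction to ℝ is a Schwartz function with all derivatives vanishing
at `0`, and which satisfy the radial Hardy bound from below. -/
def memA (f : ℂ → ℂ) : Prop :=
  AnalyticOnNhd ℂ f {z : ℂ | z.im < 0} ∧
  ContinuousOn f {z : ℂ | z.im ≤ 0} ∧
  ContDiff ℝ (⊤ : ℕ∞) (fun s : ℝ => f s) ∧
  (∀ m n : ℕ, ∃ C : ℝ, ∀ s : ℝ,
    |s| ^ m * ‖iteratedDeriv n (fun t : ℝ => f t) s‖ ≤ C) ∧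
  (∀ n : ℕ, iteratedDeriv n (fun t : ℝ => f t) 0 = 0) ∧
  Rminus f < ∞

/-- The function `w ↦ exp (-(log w)²)`, which decays faster than any power of `|w|` both at `0`
and at infinity. -/
noncomputable def expNegLogSq (w : ℂ) : ℂ := Complex.exp (-(Complex.log w) ^ 2)

lemma norm_expNegLogSq (w : ℂ) :
    ‖expNegLogSq w‖ = Real.exp (w.arg ^ 2 - Real.log ‖w‖ ^ 2) := by
  rw [expNegLogSq, Complex.norm_exp]
  congr 1
  simp [sq, Complex.mul_re, Complex.log_re, Complex.log_im]

lemma norm_expNegLogSq_le (p : ℝ) {w : ℂ} (hw : w ≠ 0) :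
    ‖expNegLogSq w‖ ≤ Real.exp (Real.pi ^ 2 + p ^ 2) * ‖w‖ ^ p := by
  rw [norm_expNegLogSq, Real.rpow_def_of_pos (norm_pos_iff.2 hw), ← Real.exp_add]
  apply Real.exp_le_exp.2
  have h : w.arg ^ 2 ≤ Real.pi ^ 2 := sq_le_sq.2 (by
    rw [abs_of_pos Real.pi_pos]; exact Complex.abs_arg_le_pi w)
  nlinarith [sq_nonneg (Real.log ‖w‖ + p), sq_nonneg (Real.log ‖w‖), sq_nonneg p,
    sq_nonneg (Real.log ‖w‖ + p / 2)]

lemma differentiableAt_expNegLogSq {w : ℂ} (hw : w ∈ Complex.slitPlane) :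
    DifferentiableAt ℂ expNegLogSq w := by
  unfold expNegLogSq
  exact ((Complex.differentiableAt_log hw).pow 2).neg.cexp

lemma analyticAt_expNegLogSq {w : ℂ} (hw : w ∈ Complex.slitPlane) :
    AnalyticAt ℂ expNegLogSq w :=
  DifferentiableOn.analyticAt (s := Complex.slitPlane)
    (fun _ hz => (differentiableAt_expNegLogSq hz).differentiableWithinAt)
    (Complex.isOpen_slitPlane.mem_nhds hw)

lemma I_mul_ofReal_mem_slitPlane {s : ℝ} (hs : s ≠ 0) :
    Complex.I * (s : ℂ) ∈ Complex.slitPlane := by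
  simp [Complex.mem_slitPlane_iff, hs]

lemma exists_norm_iteratedDeriv_expNegLogSq_le (n : ℕ) (p : ℝ) :
    ∃ C : ℝ, 0 ≤ C ∧ ∀ s : ℝ, s ≠ 0 →
      ‖iteratedDeriv n expNegLogSq (Complex.I * s)‖ ≤ C * |s| ^ p := by
  set q : ℝ := p + n
  refine ⟨n.factorial * (Real.exp (Real.pi ^ 2 + q ^ 2) * 2 ^ |q|) * 2 ^ n, by positivity, ?_⟩
  intro s hs
  have hs' : 0 < |s| := abs_pos.2 hs
  have hIs : ‖Complex.I * (s : ℂ)‖ = |s| := by simp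
  have him : ∀ w ∈ Metric.closedBall (Complex.I * (s : ℂ)) (|s| / 2),
      w ∈ Complex.slitPlane ∧ |s| / 2 ≤ ‖w‖ ∧ ‖w‖ ≤ 2 * |s| := by
    intro w hw
    rw [mem_closedBall_iff_norm] at hw
    have h1 : |w.im - s| ≤ |s| / 2 := by
      refine le_trans ?_ hw
      simpa using Complex.abs_im_le_norm (w - Complex.I * (s : ℂ))
    refine ⟨?_, ?_, ?_⟩
    · rw [Complex.mem_slitPlane_iff]
      right
      intro h
      rw [h] at h1
      simp only [zero_sub, abs_neg] at h1
      linarith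
    · have := norm_sub_norm_le (Complex.I * (s : ℂ)) w
      rw [norm_sub_rev] at this
      linarith
    · have := norm_sub_norm_le w (Complex.I * (s : ℂ))
      linarith
  have key : ∀ w ∈ Metric.sphere (Complex.I * (s : ℂ)) (|s| / 2),
      ‖expNegLogSq w‖ ≤ Real.exp (Real.pi ^ 2 + q ^ 2) * 2 ^ |q| * |s| ^ q := by
    intro w hw
    obtain ⟨h1, h2, h3⟩ := him w (Metric.sphere_subset_closedBall hw)
    refine (norm_expNegLogSq_le q (Complex.slitPlane_ne_zero h1)).trans ?_
    rw [mul_assoc]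
    gcongr
    have hw0 : 0 < ‖w‖ := by linarith
    rcases le_total 0 q with hq | hq
    · rw [abs_of_nonneg hq, ← Real.mul_rpow (by norm_num) hs'.le]
      exact Real.rpow_le_rpow hw0.le h3 hq
    · have : (2 : ℝ) ^ |q| = (1 / 2) ^ q := by
        rw [abs_of_nonpos hq, one_div, Real.inv_rpow (by norm_num), Real.rpow_neg (by norm_num)]
      rw [this, ← Real.mul_rpow (by norm_num) hs'.le]
      exact Real.rpow_le_rpow_of_nonpos (by positivity) (by linarith) hq
  have hd : DiffContOnCl ℂ expNegLogSq (Metric.ball (Complex.I * (s : ℂ)) (|s| / 2)) := by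
    apply DifferentiableOn.diffContOnCl
    intro w hw
    exact (differentiableAt_expNegLogSq
      (him w (Metric.closure_ball_subset_closedBall hw)).1).differentiableWithinAt
  have := Complex.norm_iteratedDeriv_le_of_forall_mem_sphere_norm_le n (by positivity) hd key
  refine this.trans (le_of_eq ?_)
  have hq : |s| ^ q = |s| ^ p * |s| ^ n := by
    rw [Real.rpow_add hs', Real.rpow_natCast]
  rw [hq, div_pow]
  field_simp

/-- The function `z ↦ exp (-(log (i z))²)`, extended by `0` at the origin. -/
noncomputable def lowerBump (z : ℂ) : ℂ := if z = 0 then 0 else expNegLogSq (Complex.I * z)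

lemma exists_norm_lowerBump_le (p : ℝ) :
    ∃ C : ℝ, 0 ≤ C ∧ ∀ z : ℂ, ‖lowerBump z‖ ≤ C * ‖z‖ ^ p := by
  refine ⟨Real.exp (Real.pi ^ 2 + p ^ 2), by positivity, fun z => ?_⟩
  unfold lowerBump
  split_ifs with h
  · rw [norm_zero]; positivity
  · simpa using norm_expNegLogSq_le p (mul_ne_zero Complex.I_ne_zero h)

/-- The `n`-th derivative of the restriction of `lowerBump` to the real line. -/
noncomputable def lowerBumpDeriv (n : ℕ) (s : ℝ) : ℂ :=
  if s = 0 then 0 else Complex.I ^ n * iteratedDeriv n expNegLogSq (Complex.I * s)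

lemma exists_norm_lowerBumpDeriv_le (n : ℕ) (p : ℝ) :
    ∃ C : ℝ, 0 ≤ C ∧ ∀ s : ℝ, ‖lowerBumpDeriv n s‖ ≤ C * |s| ^ p := by
  obtain ⟨C, hC, h⟩ := exists_norm_iteratedDeriv_expNegLogSq_le n p
  refine ⟨C, hC, fun s => ?_⟩
  unfold lowerBumpDeriv
  split_ifs with hs
  · rw [norm_zero]; positivity
  · simpa using h s hs

lemma hasDerivAt_lowerBumpDeriv (n : ℕ) (s : ℝ) :
    HasDerivAt (lowerBumpDeriv n) (lowerBumpDeriv (n + 1) s) s := by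
  by_cases hs : s = 0
  · subst hs
    obtain ⟨C, hC, h⟩ := exists_norm_lowerBumpDeriv_le n 2
    have h0 : ∀ k, lowerBumpDeriv k 0 = 0 := fun k => by simp [lowerBumpDeriv]
    rw [h0, hasDerivAt_iff_isLittleO]
    simp only [h0, sub_zero, smul_zero]
    refine Asymptotics.IsBigO.trans_isLittleO (g := fun s : ℝ => s ^ 2) ?_ ?_
    · refine Asymptotics.IsBigO.of_bound C (Filter.Eventually.of_forall fun s => ?_)
      simpa using h s
    · exact Asymptotics.isLittleO_pow_id one_lt_two
  · have hF : HasDerivAt (iteratedDeriv n expNegLogSq)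
        (iteratedDeriv (n + 1) expNegLogSq (Complex.I * s)) (Complex.I * s) := by
      rw [iteratedDeriv_succ]
      apply DifferentiableAt.hasDerivAt
      exact ((analyticAt_expNegLogSq (I_mul_ofReal_mem_slitPlane hs)).iterated_deriv
        n).differentiableAt.congr_of_eventuallyEq (by rw [iteratedDeriv_eq_iterate])
    have hin : HasDerivAt (fun t : ℝ => Complex.I * (t : ℂ)) Complex.I s := by
      simpa using (Complex.ofRealCLM.hasDerivAt (x := s)).const_mul Complex.I
    have := (HasDerivAt.comp s hF hin).const_mul (Complex.I ^ n)
    have he : lowerBumpDeriv (n + 1) s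
        = Complex.I ^ n * (iteratedDeriv (n + 1) expNegLogSq (Complex.I * s) * Complex.I) := by
      rw [lowerBumpDeriv, if_neg hs]; ring
    rw [he]
    refine this.congr_of_eventuallyEq ?_
    filter_upwards [isOpen_ne.mem_nhds hs] with t ht
    simp [lowerBumpDeriv, show t ≠ 0 from ht]

lemma iteratedDeriv_lowerBump (n : ℕ) :
    iteratedDeriv n (fun t : ℝ => lowerBump t) = lowerBumpDeriv n := by
  induction n with
  | zero =>
    ext s
    simp [lowerBump, lowerBumpDeriv]
  | succ n ih =>
    rw [iteratedDeriv_succ, ih]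
    ext s
    exact (hasDerivAt_lowerBumpDeriv n s).deriv

lemma analyticOnNhd_lowerBump : AnalyticOnNhd ℂ lowerBump {z : ℂ | z.im < 0} := by
  intro z hz
  have hz0 : z ≠ 0 := by rintro rfl; simp at hz
  have h : AnalyticAt ℂ (fun z => expNegLogSq (Complex.I * z)) z :=
    (analyticAt_expNegLogSq (I_mul_mem_slitPlane (le_of_lt hz) hz0)).fun_comp
      (analyticAt_const.mul analyticAt_id)
  refine h.congr ?_
  filter_upwards [isOpen_ne.mem_nhds hz0] with t ht
  simp [lowerBump, show t ≠ 0 from ht]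

lemma continuousOn_lowerBump : ContinuousOn lowerBump {z : ℂ | z.im ≤ 0} := by
  intro z hz
  apply ContinuousAt.continuousWithinAt
  by_cases hz0 : z = 0
  · subst hz0
    obtain ⟨C, -, h⟩ := exists_norm_lowerBump_le 1
    have h0 : lowerBump 0 = 0 := by simp [lowerBump]
    rw [ContinuousAt, h0]
    refine squeeze_zero_norm h ?_
    have : ContinuousAt (fun z : ℂ => C * ‖z‖ ^ (1 : ℝ)) 0 := by
      simp only [Real.rpow_one]; fun_prop
    simpa [ContinuousAt] using this
  · have h : ContinuousAt (fun z => expNegLogSq (Complex.I * z)) z :=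
      ContinuousAt.comp' (differentiableAt_expNegLogSq (I_mul_mem_slitPlane hz hz0)).continuousAt
        (by fun_prop)
    refine h.congr ?_
    filter_upwards [isOpen_ne.mem_nhds hz0] with t ht
    simp [lowerBump, show t ≠ 0 from ht]

lemma Rminus_lt_top_of_norm_le_s13 {f : ℂ → ℂ} {C : ℝ}
    (h : ∀ z, ‖f z‖ ^ 2 ≤ C * (1 + ‖z‖ ^ 2)⁻¹) : Rminus f < ∞ := by
  have hint : Integrable (fun r : ℝ => C * (1 + r ^ 2)⁻¹) := integrable_inv_one_add_sq.const_mul C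
  refine lt_of_le_of_lt ?_ hint.lintegral_lt_top
  refine iSup₂_le fun φ _ => ?_
  refine (lintegral_mono fun r => ?_).trans (setLIntegral_le_lintegral _ _)
  have := h ((r : ℂ) * Complex.exp ((φ : ℂ) * Complex.I))
  rw [norm_mul, Complex.norm_exp_ofReal_mul_I, mul_one, Complex.norm_real, Real.norm_eq_abs,
    sq_abs] at this
  refine le_trans (le_of_eq ?_) (ENNReal.ofReal_le_ofReal this)
  rw [ENNReal.ofReal_pow (norm_nonneg _), ofReal_norm]
  rfl

lemma Rminus_mono {f g : ℂ → ℂ} (h : ∀ r : ℝ, 0 < r → ∀ φ ∈ Ioo (-Real.pi) (0 : ℝ),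
    ‖f (r * Complex.exp (φ * Complex.I))‖ ≤ ‖g (r * Complex.exp (φ * Complex.I))‖) :
    Rminus f ≤ Rminus g := by
  refine iSup₂_mono fun φ hφ => ?_
  refine setLIntegral_mono' measurableSet_Ioi fun r hr => ?_
  gcongr
  exact h r hr φ hφ

lemma memA_lowerBump : memA lowerBump := by
  refine ⟨analyticOnNhd_lowerBump, continuousOn_lowerBump, ?_, ?_, ?_, ?_⟩
  · apply contDiff_of_differentiable_iteratedDeriv
    intro m _
    rw [iteratedDeriv_lowerBump]
    exact fun s => (hasDerivAt_lowerBumpDeriv m s).differentiableAt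
  · intro m n
    obtain ⟨C, hC, h⟩ := exists_norm_lowerBumpDeriv_le n (-m)
    refine ⟨C, fun s => ?_⟩
    rw [iteratedDeriv_lowerBump]
    by_cases hs : s = 0
    · simpa [hs, lowerBumpDeriv] using hC
    · have hs' : 0 < |s| := abs_pos.2 hs
      calc |s| ^ m * ‖lowerBumpDeriv n s‖ ≤ |s| ^ m * (C * |s| ^ (-m : ℝ)) := by
            gcongr; exact h s
        _ = C := by
            rw [Real.rpow_neg hs'.le, Real.rpow_natCast]
            field_simp
  · intro n
    rw [iteratedDeriv_lowerBump]
    simp [lowerBumpDeriv]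
  · obtain ⟨C, hC, h⟩ := exists_norm_lowerBump_le 0
    obtain ⟨D, hD, h'⟩ := exists_norm_lowerBump_le (-1)
    refine Rminus_lt_top_of_norm_le_s13 (C := C ^ 2 + D ^ 2) fun z => ?_
    rw [← div_eq_mul_inv, le_div_iff₀ (by positivity)]
    have h1 : ‖lowerBump z‖ ≤ C := by simpa using h z
    have h2 : ‖lowerBump z‖ * ‖z‖ ≤ D := by
      by_cases hz : z = 0
      · simpa [hz] using hD
      · have := h' z
        rwa [Real.rpow_neg_one, ← div_eq_mul_inv, le_div_iff₀ (norm_pos_iff.2 hz)] at this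
    have h3 : ‖lowerBump z‖ ^ 2 ≤ C ^ 2 := by gcongr
    have h4 : (‖lowerBump z‖ * ‖z‖) ^ 2 ≤ D ^ 2 := by gcongr
    linarith [mul_pow ‖lowerBump z‖ ‖z‖ 2]

lemma norm_exp_neg_I_mul_sqrt (b : ℝ) {r φ : ℝ} (hr : 0 < r) (hφ : φ ∈ Ioo (-Real.pi) (0 : ℝ)) :
    ‖Complex.exp (-(Complex.I * (b : ℂ) *
      ((r : ℂ) * Complex.exp ((φ : ℂ) * Complex.I)) ^ ((1 : ℂ) / 2)))‖
      = Real.exp (b * (√r * Real.sin (φ / 2))) := by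
  have hz : ((r : ℂ) * Complex.exp ((φ : ℂ) * Complex.I)) ≠ 0 :=
    mul_ne_zero (by exact_mod_cast hr.ne') (Complex.exp_ne_zero _)
  have hlog : Complex.log ((r : ℂ) * Complex.exp ((φ : ℂ) * Complex.I))
      = (Real.log r : ℂ) + φ * Complex.I := by
    rw [Complex.log_ofReal_mul hr (Complex.exp_ne_zero _), Complex.log_exp]
    · simpa using hφ.1
    · simpa using hφ.2.le.trans Real.pi_pos.le
  have hpow : ((r : ℂ) * Complex.exp ((φ : ℂ) * Complex.I)) ^ ((1 : ℂ) / 2)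
      = (√r : ℝ) * Complex.exp ((φ / 2 : ℝ) * Complex.I) := by
    rw [Complex.cpow_def_of_ne_zero hz, hlog, Real.sqrt_eq_rpow, Real.rpow_def_of_pos hr,
      Complex.ofReal_exp, ← Complex.exp_add]
    congr 1
    push_cast
    ring
  rw [hpow, Complex.norm_exp]
  congr 1
  simp only [Complex.neg_re, Complex.mul_re, Complex.mul_im, Complex.I_re, Complex.I_im,
    Complex.ofReal_re, Complex.ofReal_im, Complex.exp_ofReal_mul_I_im,
    Complex.exp_ofReal_mul_I_re]
  ring

lemma eventually_log_sq_le {c : ℝ} (hc : 0 < c) :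
    ∀ᶠ r : ℝ in Filter.atTop, Real.log r ^ 2 ≤ c * √r := by
  have h := (isLittleO_log_rpow_rpow_atTop (s := 1 / 2) 2 (by norm_num)).bound hc
  filter_upwards [h, Filter.eventually_ge_atTop 1] with r hr h1
  rw [← Real.sqrt_eq_rpow, Real.norm_of_nonneg (Real.sqrt_nonneg r)] at hr
  refine le_trans (le_of_eq ?_) ((le_abs_self _).trans hr)
  exact (Real.rpow_natCast _ 2).symm

lemma Rminus_exp_mul_lowerBump {b : ℝ} (hb : b < 0) :
    Rminus (fun z : ℂ =>
      Complex.exp (-(Complex.I * (b : ℂ) * z ^ ((1 : ℂ) / 2))) * lowerBump z) = ∞ := by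
  have hφ : -(Real.pi / 2) ∈ Ioo (-Real.pi) (0 : ℝ) :=
    ⟨by linarith [Real.pi_pos], by linarith [Real.pi_pos]⟩
  set c : ℝ := b * Real.sin (-(Real.pi / 2) / 2)
  have hc : 0 < c := mul_pos_of_neg_of_neg hb
    (Real.sin_neg_of_neg_of_neg_pi_lt (by linarith [Real.pi_pos]) (by linarith [Real.pi_pos]))
  obtain ⟨R, hR⟩ := Filter.eventually_atTop.1 (eventually_log_sq_le hc)
  refine top_unique (le_trans ?_ (le_iSup₂ (-(Real.pi / 2)) hφ))
  have hvol : (∞ : ℝ≥0∞) = ∫⁻ _ in Ioi (max R 0), 1 := by simp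
  rw [hvol]
  refine (setLIntegral_mono' measurableSet_Ioi fun r hr => ?_).trans
    (lintegral_mono_set (Ioi_subset_Ioi (le_max_right R 0)))
  have hr0 : 0 < r := (le_max_right R 0).trans_lt hr
  have hz : (r : ℂ) * Complex.exp (((-(Real.pi / 2) : ℝ) : ℂ) * Complex.I)
      = -Complex.I * r := by
    rw [Complex.exp_mul_I, ← Complex.ofReal_cos, ← Complex.ofReal_sin]
    simp [mul_comm]
  have hbump : ‖lowerBump ((r : ℂ) * Complex.exp (((-(Real.pi / 2) : ℝ) : ℂ) * Complex.I))‖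
      = Real.exp (-Real.log r ^ 2) := by
    have hI : Complex.I * (-Complex.I * (r : ℂ)) = r := by
      rw [← mul_assoc, mul_neg, Complex.I_mul_I]; simp
    rw [hz, lowerBump, if_neg (by simp [hr0.ne']), hI, norm_expNegLogSq,
      Complex.arg_ofReal_of_nonneg hr0.le, Complex.norm_real, Real.norm_of_nonneg hr0.le]
    simp
  refine one_le_pow₀ ?_
  rw [ENNReal.one_le_coe_iff, ← NNReal.coe_le_coe, coe_nnnorm, norm_mul,
    norm_exp_neg_I_mul_sqrt b hr0 hφ, hbump, ← Real.exp_add, NNReal.coe_one]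
  apply Real.one_le_exp
  have := hR r ((le_max_left R 0).trans hr.le)
  have he : b * (√r * Real.sin (-(Real.pi / 2) / 2)) = c * √r := by ring
  linarith

theorem stmt13 (b : ℝ) :
    (∀ f : ℂ → ℂ, memA f →
        Rminus (fun z : ℂ => Complex.exp (-(Complex.I * (b : ℂ) * z ^ ((1 : ℂ) / 2))) * f z) < ∞)
      ↔ 0 ≤ b := by
  constructor
  · intro h
    by_contra! hb
    exact (h lowerBump memA_lowerBump).ne (Rminus_exp_mul_lowerBump hb)
  · intro hb f hf
    refine (Rminus_mono fun r hr φ hφ => ?_).trans_lt hf.2.2.2.2.2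
    rw [norm_mul, norm_exp_neg_I_mul_sqrt b hr hφ]
    refine mul_le_of_le_one_left (norm_nonneg _) (Real.exp_le_one_iff.2 ?_)
    refine mul_nonpos_of_nonneg_of_nonpos hb
      (mul_nonpos_of_nonneg_of_nonpos (Real.sqrt_nonneg r) ?_)
    exact Real.sin_nonpos_of_nonpos_of_neg_pi_le (by linarith [hφ.2])
      (by linarith [hφ.1, Real.pi_pos])
end
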